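/- arXiv:0812.3188 — 3 statements merged into one kernel-verified Lean document; each statement's English description precedes it below -/
import Mathlib

section
/- Let φ : [0,1] → ℝ be continuous and nondecreasing and continuously differentiable on a neighborhood of 1 in [0,1]. For t ∈ [0, n^{1/3}] define Δ_n(t) = n^{−1/3} ∑_{j=1}^{⌊n^{2/3} t⌋} ( φ(1) − φ((n − j + 1)/n) ). Then Δ_n(t) → (1/2) φ′(1) t² as n → ∞, uniformly on compact subsets of [0, ∞): for every b > 0, sup_{0 ≤ t ≤ b} | Δ_n(t) − (1/2) φ′(1) t² | → 0. -/
theorem sum_Icc_one_natCast_sub_one (k : ℕ) :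
    ∑ j ∈ Finset.Icc 1 k, ((j : ℝ) - 1) = (k : ℝ) * (k - 1) / 2 := by
  induction k with
  | zero => simp
  | succ k ih =>
    rw [Finset.sum_Icc_succ_top (by omega), ih]
    push_cast
    ring

/-- First-order expansion of `f` to the left of `1`, with an error linear in the step. -/
theorem exists_abs_sub_sub_mul_le {f : ℝ → ℝ} {a : ℝ}
    (hf : HasDerivWithinAt f a (Set.Icc 0 1) 1) {η : ℝ} (hη : 0 < η) :
    ∃ ρ > 0, ∀ h, 0 ≤ h → h ≤ ρ → |f 1 - f (1 - h) - a * h| ≤ η * h := by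
  have hlin := (hasDerivWithinAt_iff_isLittleO.mp hf).def hη
  obtain ⟨r, hr, hball⟩ := Metric.mem_nhdsWithin_iff.mp hlin
  refine ⟨min 1 (r / 2), by positivity, fun h h0 hh => ?_⟩
  have h1 : h ≤ 1 := hh.trans (min_le_left _ _)
  have h2 : h ≤ r / 2 := hh.trans (min_le_right _ _)
  have hmem : 1 - h ∈ Metric.ball (1 : ℝ) r ∩ Set.Icc 0 1 := by
    refine ⟨?_, by linarith, by linarith⟩
    rw [Metric.mem_ball, Real.dist_eq, sub_sub_cancel_left, abs_neg, abs_of_nonneg h0]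
    linarith
  have key := hball hmem
  simp only [Set.mem_ofPred_eq, Real.norm_eq_abs, smul_eq_mul, sub_sub_cancel_left, abs_neg,
    abs_of_nonneg h0] at key
  rw [abs_sub_comm] at key
  convert key using 2
  ring_nf

/-- The rescaled sum of left increments of `f` at `1`, at scale `n = m ^ 3`, compared with the
quadratic limit. -/
theorem abs_rescaled_sum_sub_le {f : ℝ → ℝ} {a η ρ m t b : ℝ} (hη : 0 ≤ η)
    (hf : ∀ h, 0 ≤ h → h ≤ ρ → |f 1 - f (1 - h) - a * h| ≤ η * h)
    (hm : 1 ≤ m) (ht : 0 ≤ t) (htb : t ≤ b) (hbm : b ≤ ρ * m) :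
    |m⁻¹ * ∑ j ∈ Finset.Icc 1 ⌊m ^ 2 * t⌋₊, (f 1 - f ((m ^ 3 - j + 1) / m ^ 3))
      - 1 / 2 * a * t ^ 2| ≤ η * b ^ 2 / 2 + |a| * (3 * b) / (2 * m) := by
  have hm0 : 0 < m := by linarith
  set k := ⌊m ^ 2 * t⌋₊
  have hx0 : 0 ≤ m ^ 2 * t := by positivity
  have hkx : (k : ℝ) ≤ m ^ 2 * t := Nat.floor_le hx0
  have hxk : m ^ 2 * t < k + 1 := Nat.lt_floor_add_one _
  have hk0 : (0 : ℝ) ≤ k := Nat.cast_nonneg k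
  have hkk : (k : ℝ) * (k - 1) ≤ (m ^ 2 * t) ^ 2 := by nlinarith
  have hkk' : (m ^ 2 * t) ^ 2 - 3 * (m ^ 2 * t) ≤ (k : ℝ) * (k - 1) := by nlinarith
  have hsum : ∑ j ∈ Finset.Icc 1 k, ((j : ℝ) - 1) / m ^ 3 = k * (k - 1) / 2 / m ^ 3 := by
    rw [← Finset.sum_div, sum_Icc_one_natCast_sub_one]
  have hterm : |∑ j ∈ Finset.Icc 1 k, (f 1 - f ((m ^ 3 - j + 1) / m ^ 3))
      - a * (k * (k - 1) / 2 / m ^ 3)| ≤ η * (k * (k - 1) / 2 / m ^ 3) := by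
    rw [← hsum, Finset.mul_sum, Finset.mul_sum, ← Finset.sum_sub_distrib]
    refine (Finset.abs_sum_le_sum_abs _ _).trans (Finset.sum_le_sum fun j hj => ?_)
    obtain ⟨hj1, hjk⟩ := Finset.mem_Icc.mp hj
    have hj1' : (1 : ℝ) ≤ j := by exact_mod_cast hj1
    have hjk' : (j : ℝ) ≤ k := by exact_mod_cast hjk
    have harg : (m ^ 3 - j + 1) / m ^ 3 = 1 - ((j : ℝ) - 1) / m ^ 3 := by
      field_simp
      ring
    rw [harg]
    refine hf _ (div_nonneg (by linarith) (by positivity)) ?_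
    rw [div_le_iff₀ (by positivity)]
    calc (j : ℝ) - 1 ≤ m ^ 2 * t := by linarith
      _ ≤ m ^ 2 * (ρ * m) := by gcongr; linarith
      _ = ρ * m ^ 3 := by ring
  have hmain : |m⁻¹ * ∑ j ∈ Finset.Icc 1 k, (f 1 - f ((m ^ 3 - j + 1) / m ^ 3))
      - a * (k * (k - 1) / (2 * m ^ 4))| ≤ η * b ^ 2 / 2 := by
    calc _ = m⁻¹ * |∑ j ∈ Finset.Icc 1 k, (f 1 - f ((m ^ 3 - j + 1) / m ^ 3))
          - a * (k * (k - 1) / 2 / m ^ 3)| := by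
          rw [← abs_of_pos (inv_pos.mpr hm0), ← abs_mul, abs_of_pos (inv_pos.mpr hm0), mul_sub]
          congr 2
          field_simp
      _ ≤ m⁻¹ * (η * (k * (k - 1) / 2 / m ^ 3)) := by gcongr
      _ ≤ m⁻¹ * (η * ((m ^ 2 * t) ^ 2 / 2 / m ^ 3)) := by gcongr
      _ = η * t ^ 2 / 2 := by field_simp
      _ ≤ η * b ^ 2 / 2 := by gcongr
  have hquad : |(k : ℝ) * (k - 1) / (2 * m ^ 4) - 1 / 2 * t ^ 2| ≤ 3 * b / (2 * m) := by
    have heq : (k : ℝ) * (k - 1) / (2 * m ^ 4) - 1 / 2 * t ^ 2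
        = (k * (k - 1) - (m ^ 2 * t) ^ 2) / (2 * m ^ 4) := by
      field_simp
    have hnum : |(k : ℝ) * (k - 1) - (m ^ 2 * t) ^ 2| ≤ 3 * (m ^ 2 * t) :=
      abs_le.mpr ⟨by linarith, by linarith⟩
    rw [heq, abs_div, abs_of_pos (by positivity : 0 < 2 * m ^ 4)]
    calc _ ≤ 3 * (m ^ 2 * t) / (2 * m ^ 4) := by gcongr
      _ = 3 * t / (2 * m ^ 2) := by field_simp
      _ ≤ 3 * b / (2 * m) := by
        have : m ≤ m ^ 2 := by nlinarith
        have : 0 ≤ b := ht.trans htb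
        gcongr
  have hquad' := mul_le_mul_of_nonneg_left hquad (abs_nonneg a)
  rw [← abs_mul] at hquad'
  calc _ = |(m⁻¹ * ∑ j ∈ Finset.Icc 1 k, (f 1 - f ((m ^ 3 - j + 1) / m ^ 3))
        - a * (k * (k - 1) / (2 * m ^ 4)))
        + a * ((k : ℝ) * (k - 1) / (2 * m ^ 4) - 1 / 2 * t ^ 2)| := by
        congr 1
        ring
    _ ≤ _ := (abs_add_le _ _).trans (add_le_add hmain (hquad'.trans_eq (by ring)))

/-- If `φ` is continuous and nondecreasing on `[0,1]`, continuously
differentiable near `1` with derivative `d`, and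
`Δₙ(t) = n^{-1/3} ∑_{j=1}^{⌊n^{2/3}t⌋} (φ(1) - φ((n-j+1)/n))`, then
`Δₙ(t) → (1/2)φ′(1)t²` uniformly on compact subsets of `[0,∞)`. -/
theorem Delta_n_uniform_limit
    (φ : ℝ → ℝ) (hφc : ContinuousOn φ (Set.Icc 0 1))
    (hφm : MonotoneOn φ (Set.Icc 0 1))
    (δ : ℝ) (hδ : 0 < δ) (d : ℝ → ℝ)
    (hd : ∀ x ∈ Set.Icc (0 : ℝ) 1 ∩ Set.Icc (1 - δ) (1 + δ),
      HasDerivWithinAt φ (d x) (Set.Icc 0 1) x)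
    (hdcont : ContinuousOn d (Set.Icc (0 : ℝ) 1 ∩ Set.Icc (1 - δ) (1 + δ)))
    (Δ : ℕ → ℝ → ℝ)
    (hΔ : ∀ n t, Δ n t = (n : ℝ) ^ (-(1 : ℝ) / 3) *
      ∑ j ∈ Finset.Icc 1 ⌊(n : ℝ) ^ ((2 : ℝ) / 3) * t⌋₊,
        (φ 1 - φ (((n : ℝ) - j + 1) / n))) :
    ∀ b : ℝ, 0 < b → ∀ ε : ℝ, 0 < ε → ∃ N : ℕ, ∀ n ≥ N,
      ∀ t ∈ Set.Icc (0 : ℝ) b, t ≤ (n : ℝ) ^ ((1 : ℝ) / 3) →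
        |Δ n t - 1 / 2 * d 1 * t ^ 2| ≤ ε := by
  intro b hb ε hε
  have hderiv := hd 1 ⟨⟨zero_le_one, le_rfl⟩, by linarith, by linarith⟩
  obtain ⟨ρ, hρ, hlin⟩ := exists_abs_sub_sub_mul_le hderiv (η := ε / b ^ 2) (by positivity)
  have htend : Filter.Tendsto (fun n : ℕ => (n : ℝ) ^ ((1 : ℝ) / 3)) Filter.atTop Filter.atTop :=
    (tendsto_rpow_atTop (by norm_num)).comp tendsto_natCast_atTop_atTop
  obtain ⟨N, hN⟩ := Filter.eventually_atTop.mp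
    ((htend.eventually_ge_atTop 1).and ((htend.eventually_ge_atTop (b / ρ)).and
      (htend.eventually_ge_atTop (3 * b * |d 1| / ε))))
  refine ⟨N, fun n hn t ht _ => ?_⟩
  obtain ⟨hm1, hm2, hm3⟩ := hN n hn
  have hn0 : (0 : ℝ) ≤ n := Nat.cast_nonneg n
  rw [hΔ]
  have hinv : (n : ℝ) ^ (-(1 : ℝ) / 3) = ((n : ℝ) ^ ((1 : ℝ) / 3))⁻¹ := by
    rw [← Real.rpow_neg hn0]
    norm_num
  have hsq : (n : ℝ) ^ ((2 : ℝ) / 3) = ((n : ℝ) ^ ((1 : ℝ) / 3)) ^ 2 := by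
    rw [← Real.rpow_mul_natCast hn0]
    norm_num
  have hcube : (n : ℝ) = ((n : ℝ) ^ ((1 : ℝ) / 3)) ^ 3 := by
    rw [← Real.rpow_mul_natCast hn0]
    norm_num
  rw [hinv, hsq]
  generalize (n : ℝ) ^ ((1 : ℝ) / 3) = m at *
  rw [hcube]
  have hm0 : 0 < m := by linarith
  rw [div_le_iff₀ hρ] at hm2
  rw [div_le_iff₀ hε] at hm3
  refine (abs_rescaled_sum_sub_le (by positivity) hlin hm1 ht.1 ht.2
    (by linarith)).trans ?_
  have h1 : ε / b ^ 2 * b ^ 2 / 2 = ε / 2 := by field_simp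
  have h2 : |d 1| * (3 * b) / (2 * m) ≤ ε / 2 := by
    rw [div_le_div_iff₀ (by positivity) two_pos]
    linarith
  linarith
end

section
/- Let φ : [0,1] → ℝ be continuous and nondecreasing, continuously differentiable on a neighborhood of 1 in [0,1], with φ′(1) > 0. For t ∈ [0, n^{1/3}] define Δ_n(t) = n^{−1/3} ∑_{j=1}^{⌊n^{2/3} t⌋} ( φ(1) − φ((n − j + 1)/n) ). Then there exists η > 0 such that Δ_n(t) ≥ 2 η t² for every integer n ≥ 6 and every t with 6 n^{−2/3} ≤ t ≤ n^{1/3}. -/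
/-- A monotone function on `[0,1]` with positive derivative at `1` satisfies a global linear lower
bound on its deficit from the value at `1`. -/
theorem MonotoneOn.exists_linear_lower_bound_of_hasDerivWithinAt {φ : ℝ → ℝ} {d : ℝ}
    (hφ : MonotoneOn φ (Set.Icc 0 1)) (hd : HasDerivWithinAt φ d (Set.Icc 0 1) 1) (hd0 : 0 < d) :
    ∃ c : ℝ, 0 < c ∧ ∀ x ∈ Set.Icc (0 : ℝ) 1, c * (1 - x) ≤ φ 1 - φ x := by
  have hev := hd.isLittleO.bound (half_pos hd0)
  obtain ⟨ε, hε, hball⟩ := Metric.mem_nhdsWithin_iff.1 hev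
  have near : ∀ x ∈ Set.Icc (0 : ℝ) 1, 1 - x < ε → d / 2 * (1 - x) ≤ φ 1 - φ x := by
    intro x hx hxε
    have hx' : x ∈ Metric.ball (1 : ℝ) ε := by
      rw [Metric.mem_ball, Real.dist_eq, abs_sub_comm, abs_of_nonneg (by linarith [hx.2])]
      exact hxε
    have h := hball ⟨hx', hx⟩
    simp only [Set.mem_ofPred_eq, smul_eq_mul, Real.norm_eq_abs] at h
    rw [abs_sub_comm x 1, abs_of_nonneg (show 0 ≤ 1 - x by linarith [hx.2])] at h
    linarith [(abs_le.1 h).2]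
  set r := min (ε / 2) 1
  have hr0 : 0 < r := lt_min (half_pos hε) one_pos
  have hr1 : r ≤ 1 := min_le_right _ _
  have hrε : r < ε := (min_le_left _ _).trans_lt (half_lt_self hε)
  have hr : 1 - r ∈ Set.Icc (0 : ℝ) 1 := ⟨by linarith, by linarith⟩
  refine ⟨d / 2 * r, by positivity, fun x hx => ?_⟩
  rcases le_total (1 - x) r with h | h
  · have := near x hx (h.trans_lt hrε)
    have : d / 2 * r * (1 - x) ≤ d / 2 * (1 - x) :=
      mul_le_mul_of_nonneg_right (mul_le_of_le_one_right (by positivity) hr1) (by linarith [hx.2])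
    linarith
  · have h1 := near (1 - r) hr (by linarith)
    have h2 := hφ hx hr (by linarith)
    have : d / 2 * r * (1 - x) ≤ d / 2 * r :=
      mul_le_of_le_one_right (by positivity) (by linarith [hx.1])
    linarith

theorem sum_Icc_natCast_sub_one (m : ℕ) :
    ∑ j ∈ Finset.Icc 1 m, ((j : ℝ) - 1) = (m : ℝ) * (m - 1) / 2 := by
  induction m with
  | zero => simp
  | succ k ih =>
    rw [Finset.sum_Icc_succ_top (by omega), ih]
    push_cast
    ring

/-- If `φ` is continuous and nondecreasing on `[0,1]`, continuously
differentiable near `1` with derivative `d` and `φ′(1) > 0`, then with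
`Δₙ(t) = n^{-1/3} ∑_{j=1}^{⌊n^{2/3}t⌋} (φ(1) - φ((n-j+1)/n))` there exists `η > 0`
such that `Δₙ(t) ≥ 2ηt²` for all `n ≥ 6` and `6n^{-2/3} ≤ t ≤ n^{1/3}`. -/
theorem Delta_n_lower_bound
    (φ : ℝ → ℝ) (hφc : ContinuousOn φ (Set.Icc 0 1))
    (hφm : MonotoneOn φ (Set.Icc 0 1))
    (δ : ℝ) (hδ : 0 < δ) (d : ℝ → ℝ)
    (hd : ∀ x ∈ Set.Icc (0 : ℝ) 1 ∩ Set.Icc (1 - δ) (1 + δ),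
      HasDerivWithinAt φ (d x) (Set.Icc 0 1) x)
    (hdcont : ContinuousOn d (Set.Icc (0 : ℝ) 1 ∩ Set.Icc (1 - δ) (1 + δ)))
    (hd1 : 0 < d 1)
    (Δ : ℕ → ℝ → ℝ)
    (hΔ : ∀ n t, Δ n t = (n : ℝ) ^ (-(1 : ℝ) / 3) *
      ∑ j ∈ Finset.Icc 1 ⌊(n : ℝ) ^ ((2 : ℝ) / 3) * t⌋₊,
        (φ 1 - φ (((n : ℝ) - j + 1) / n))) :
    ∃ η : ℝ, 0 < η ∧ ∀ n : ℕ, 6 ≤ n → ∀ t : ℝ,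
      6 * (n : ℝ) ^ (-(2 : ℝ) / 3) ≤ t → t ≤ (n : ℝ) ^ ((1 : ℝ) / 3) →
        2 * η * t ^ 2 ≤ Δ n t := by
  obtain ⟨c, hc, hlin⟩ := hφm.exists_linear_lower_bound_of_hasDerivWithinAt
    (hd 1 ⟨by simp, by linarith, by linarith⟩) hd1
  refine ⟨c / 8, by positivity, fun n hn t ht₁ ht₂ => ?_⟩
  have hn0 : (0 : ℝ) < n := by exact_mod_cast (by omega : 0 < n)
  obtain ⟨a, ha⟩ : ∃ a : ℝ, a = (n : ℝ) ^ ((1 : ℝ) / 3) := ⟨_, rfl⟩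
  have ha0 : 0 < a := ha ▸ Real.rpow_pos_of_pos hn0 _
  have hpow : (n : ℝ) ^ ((2 : ℝ) / 3) = a ^ 2 := by
    rw [ha, ← Real.rpow_natCast, ← Real.rpow_mul hn0.le]; norm_num
  have ha3 : (n : ℝ) = a ^ 3 := by
    rw [ha, ← Real.rpow_natCast, ← Real.rpow_mul hn0.le]; norm_num
  rw [neg_div, Real.rpow_neg hn0.le, hpow, ← div_eq_mul_inv, div_le_iff₀ (by positivity)] at ht₁
  rw [← ha] at ht₂
  rw [hΔ, neg_div, Real.rpow_neg hn0.le, hpow, ← ha]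
  set s := a ^ 2 * t with hs
  have hs6 : 6 ≤ s := by linarith
  have hsn : s ≤ n := by
    rw [ha3, hs, pow_succ a 2]
    gcongr
  set m := ⌊s⌋₊
  have hms : (m : ℝ) ≤ s := Nat.floor_le (by linarith)
  have hsm : s < m + 1 := Nat.lt_floor_add_one s
  have hsum : c / n * ((m : ℝ) * (m - 1) / 2) ≤
      ∑ j ∈ Finset.Icc 1 m, (φ 1 - φ (((n : ℝ) - j + 1) / n)) := by
    rw [← sum_Icc_natCast_sub_one, Finset.mul_sum]
    refine Finset.sum_le_sum fun j hj => ?_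
    rw [Finset.mem_Icc] at hj
    have hj1 : (1 : ℝ) ≤ j := by exact_mod_cast hj.1
    have hjm : (j : ℝ) ≤ m := by exact_mod_cast hj.2
    have hx : ((n : ℝ) - j + 1) / n ∈ Set.Icc (0 : ℝ) 1 :=
      ⟨div_nonneg (by linarith) hn0.le, (div_le_one hn0).2 (by linarith)⟩
    refine le_trans (le_of_eq ?_) (hlin _ hx)
    field_simp
    ring
  have hquad : s ^ 2 / 2 ≤ (m : ℝ) * (m - 1) := by nlinarith
  calc 2 * (c / 8) * t ^ 2 = a⁻¹ * (c / n * (s ^ 2 / 2 / 2)) := by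
        rw [ha3, hs]
        field_simp
        norm_num
    _ ≤ a⁻¹ * (c / n * ((m : ℝ) * (m - 1) / 2)) := by
        refine mul_le_mul_of_nonneg_left ?_ (inv_nonneg.2 ha0.le)
        exact mul_le_mul_of_nonneg_left (by linarith) (by positivity)
    _ ≤ _ := mul_le_mul_of_nonneg_left hsum (inv_nonneg.2 ha0.le)
end

section
/- Let γ > 0, c > 0, M ≥ 1, and let I ⊆ ℝ be a closed bounded interval. Let g : I → ℝ be convex with g(s) ≥ (9/10) γ · min(s², |s|) for all s ∈ I and, in addition, (9/10) γ s² ≤ g(s) ≤ (11/10) γ s² for all s ∈ I with |s| ≤ M. Let e : I → ℝ satisfy |e(s)| ≤ (1/10) γ · min(s², |s|) + c for all s ∈ I, and suppose f = g + e is bounded and continuous at all but finitely many points of I. Let b₁ ≤ a₁ ≤ a₂ ≤ b₂ with [b₁, b₂] ⊆ I ∩ [−M, M], b₁ ≤ min(0, a₁), b₂ ≥ max(0, a₂), and γ (a_i² + b_i² − 6 a_i b_i) > 20 c for i = 1, 2. Then G_I f(x) = G_{[b₁,b₂]} f(x) for all x ∈ [a₁, a₂]. -/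
/-- The greatest convex minorant of `f` on the set `J`, evaluated at `x`:
the supremum of `g(x)` over all functions `g` convex on `J` with `g ≤ f` on `J`. -/
noncomputable def gcm (J : Set ℝ) (f : ℝ → ℝ) (x : ℝ) : ℝ :=
  sSup {v : ℝ | ∃ g : ℝ → ℝ, ConvexOn ℝ J g ∧ (∀ y ∈ J, g y ≤ f y) ∧ v = g x}

open Set

/-- A convex function on a real set has a supporting line at each interior point. -/
theorem ConvexOn.exists_supporting_line {S : Set ℝ} {h : ℝ → ℝ} {x : ℝ} (hh : ConvexOn ℝ S h)
    (hx : x ∈ interior S) : ∃ p : ℝ, ∀ y ∈ S, h x + p * (y - x) ≤ h y := by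
  refine ⟨derivWithin h (Ioi x) x, fun y hy ↦ ?_⟩
  rcases lt_trichotomy x y with hxy | rfl | hyx
  · have := hh.rightDeriv_le_slope_of_mem_interior hx hy hxy
    rw [slope_def_field, le_div_iff₀ (sub_pos.2 hxy)] at this
    linarith
  · simp
  · have := (hh.slope_le_leftDeriv_of_mem_interior hy hx hyx).trans
      (hh.leftDeriv_le_rightDeriv_of_mem_interior hx)
    rw [slope_def_field, div_le_iff₀ (sub_pos.2 hyx)] at this
    linarith

/-- If a line is above a convex function at `x` and below it at `b`, then it remains below it
at every point `s` such that `b` lies strictly between `x` and `s`. -/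
theorem ConvexOn.affine_le_of_mem_openSegment {S : Set ℝ} {φ : ℝ → ℝ} {x b s v p : ℝ}
    (hφ : ConvexOn ℝ S φ) (hx : x ∈ S) (hs : s ∈ S) (hb : b ∈ openSegment ℝ x s)
    (hxv : φ x ≤ v) (hbv : v + p * (b - x) ≤ φ b) : v + p * (s - x) ≤ φ s := by
  obtain ⟨α, β, hα, hβ, hαβ, rfl⟩ := hb
  have h := hφ.2 hx hs hα.le hβ.le hαβ
  simp only [smul_eq_mul] at h hbv
  obtain rfl : α = 1 - β := by linarith
  have h2 := mul_le_mul_of_nonneg_left hxv hα.le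
  refine le_of_mul_le_mul_left ?_ hβ
  linarith

/-- The set of values of convex minorants is bounded above by the value of the function. -/
theorem gcm_bddAbove {J : Set ℝ} (f : ℝ → ℝ) {x : ℝ} (hx : x ∈ J) :
    BddAbove {v : ℝ | ∃ g : ℝ → ℝ, ConvexOn ℝ J g ∧ (∀ y ∈ J, g y ≤ f y) ∧ v = g x} :=
  ⟨f x, by rintro _ ⟨g, -, hg, rfl⟩; exact hg x hx⟩

theorem le_gcm {J : Set ℝ} {f h : ℝ → ℝ} {x : ℝ} (hx : x ∈ J) (hh : ConvexOn ℝ J h)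
    (hhf : ∀ y ∈ J, h y ≤ f y) : h x ≤ gcm J f x :=
  le_csSup (gcm_bddAbove f hx) ⟨h, hh, hhf, rfl⟩

theorem gcm_le {J : Set ℝ} {f : ℝ → ℝ} {x B : ℝ} (hJ : Convex ℝ J)
    (hf : ∃ C : ℝ, ∀ y ∈ J, C ≤ f y)
    (hB : ∀ h : ℝ → ℝ, ConvexOn ℝ J h → (∀ y ∈ J, h y ≤ f y) → h x ≤ B) : gcm J f x ≤ B := by
  obtain ⟨C, hC⟩ := hf
  refine csSup_le ⟨C, fun _ ↦ C, convexOn_const C hJ, hC, rfl⟩ ?_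
  rintro _ ⟨h, hh, hhf, rfl⟩
  exact hB h hh hhf

/-- A line which at `x` is above the lower quadratic barrier and at the midpoint of `x` and `b`
is below the upper one lies, under the gap condition, below the lower barrier at `b`. -/
theorem affine_le_of_quadratic_gap {γ c x b v p : ℝ}
    (hv : 4 / 5 * γ * x ^ 2 - c ≤ v)
    (hmid : v + p * ((x + b) / 2 - x) ≤ 6 / 5 * γ * ((x + b) / 2) ^ 2 + c)
    (hgap : 20 * c < γ * (x ^ 2 + b ^ 2 - 6 * x * b)) :
    v + p * (b - x) ≤ 4 / 5 * γ * b ^ 2 - c := by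
  linarith

/-- Localization of the greatest convex minorant of a perturbed convex
function `f = g + e`: if `g` is convex with quadratic growth, `e` is a small perturbation,
and `b₁ ≤ a₁ ≤ a₂ ≤ b₂` satisfy `γ(aᵢ² + bᵢ² − 6aᵢbᵢ) > 20c`, then
`G_I f = G_{[b₁,b₂]} f` on `[a₁, a₂]`. -/
theorem gcm_localization_perturbed
    (γ c M : ℝ) (hγ : 0 < γ) (hc : 0 < c) (hM : 1 ≤ M)
    (l u : ℝ) (hlu : l ≤ u)
    (g : ℝ → ℝ) (hgconv : ConvexOn ℝ (Set.Icc l u) g)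
    (hglb : ∀ s ∈ Set.Icc l u, 9 / 10 * γ * min (s ^ 2) |s| ≤ g s)
    (hgquad : ∀ s ∈ Set.Icc l u, |s| ≤ M →
      9 / 10 * γ * s ^ 2 ≤ g s ∧ g s ≤ 11 / 10 * γ * s ^ 2)
    (e : ℝ → ℝ)
    (he : ∀ s ∈ Set.Icc l u, |e s| ≤ 1 / 10 * γ * min (s ^ 2) |s| + c)
    (f : ℝ → ℝ) (hf : ∀ s, f s = g s + e s)
    (hbdd : ∃ C : ℝ, ∀ x ∈ Set.Icc l u, |f x| ≤ C)
    (hcont : ∃ s : Finset ℝ, ∀ x ∈ Set.Icc l u, x ∉ s →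
      ContinuousWithinAt f (Set.Icc l u) x)
    (a₁ a₂ b₁ b₂ : ℝ)
    (hb₁a₁ : b₁ ≤ a₁) (ha : a₁ ≤ a₂) (ha₂b₂ : a₂ ≤ b₂)
    (hsub : Set.Icc b₁ b₂ ⊆ Set.Icc l u ∩ Set.Icc (-M) M)
    (hb₁0 : b₁ ≤ min 0 a₁) (hb₂0 : max 0 a₂ ≤ b₂)
    (hgap1 : 20 * c < γ * (a₁ ^ 2 + b₁ ^ 2 - 6 * a₁ * b₁))
    (hgap2 : 20 * c < γ * (a₂ ^ 2 + b₂ ^ 2 - 6 * a₂ * b₂)) :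
    ∀ x ∈ Set.Icc a₁ a₂, gcm (Set.Icc l u) f x = gcm (Set.Icc b₁ b₂) f x := by
  obtain ⟨C, hC⟩ := hbdd
  have hsubI : Icc b₁ b₂ ⊆ Icc l u := fun y hy ↦ (hsub hy).1
  have hC' : ∀ y ∈ Icc l u, -C ≤ f y := fun y hy ↦ (abs_le.1 (hC y hy)).1
  obtain ⟨hb₁, -⟩ := le_min_iff.1 hb₁0
  obtain ⟨hb₂, -⟩ := max_le_iff.1 hb₂0
  rintro x ⟨hx₁, hx₂⟩
  have hxJ : x ∈ Icc b₁ b₂ := ⟨hb₁a₁.trans hx₁, hx₂.trans ha₂b₂⟩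
  have hxI := hsubI hxJ
  apply le_antisymm
  · refine gcm_le (convex_Icc l u) ⟨-C, hC'⟩ fun h hh hhf ↦ ?_
    exact le_gcm hxJ (hh.subset hsubI (convex_Icc _ _)) fun y hy ↦ hhf y (hsubI hy)
  refine gcm_le (convex_Icc b₁ b₂) ⟨-C, fun y hy ↦ hC' y (hsubI hy)⟩ fun h hh hhf ↦ ?_
  have gap₁ : 20 * c < γ * (x ^ 2 + b₁ ^ 2 - 6 * x * b₁) := by
    refine hgap1.trans_le (mul_le_mul_of_nonneg_left ?_ hγ.le)
    nlinarith [mul_nonneg (sub_nonneg.2 hx₁) (by linarith : 0 ≤ x + a₁ - 6 * b₁)]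
  have gap₂ : 20 * c < γ * (x ^ 2 + b₂ ^ 2 - 6 * x * b₂) := by
    refine hgap2.trans_le (mul_le_mul_of_nonneg_left ?_ hγ.le)
    nlinarith [mul_nonneg (sub_nonneg.2 hx₂) (by linarith : 0 ≤ 6 * b₂ - x - a₂)]
  have hbx : b₁ < x := by
    refine lt_of_le_of_ne hxJ.1 fun hEq ↦ ?_
    subst hEq
    nlinarith [mul_nonneg hγ.le (sq_nonneg b₁)]
  have hxb : x < b₂ := by
    refine lt_of_le_of_ne hxJ.2 fun hEq ↦ ?_
    subst hEq
    nlinarith [mul_nonneg hγ.le (sq_nonneg x)]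
  -- a convex lower barrier for `f`
  set φ : ℝ → ℝ := fun s ↦ 8 / 9 * g s - c with hφdef
  have hφ : ConvexOn ℝ (Icc l u) φ := by
    have := (hgconv.smul (by norm_num : (0 : ℝ) ≤ 8 / 9)).add_const (-c)
    simpa [hφdef, sub_eq_add_neg, Pi.add_def] using this
  have hφf : ∀ s ∈ Icc l u, φ s ≤ f s := fun s hs ↦ by
    have h1 := (abs_le.1 (he s hs)).1
    have h2 := hglb s hs
    simp only [hφdef, hf]
    linarith
  have hφlb : ∀ s ∈ Icc b₁ b₂, 4 / 5 * γ * s ^ 2 - c ≤ φ s := fun s hs ↦ by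
    have h1 := (hgquad s (hsubI hs) (abs_le.2 (hsub hs).2)).1
    simp only [hφdef]
    linarith
  have hfub : ∀ s ∈ Icc b₁ b₂, f s ≤ 6 / 5 * γ * s ^ 2 + c := fun s hs ↦ by
    have h1 := (hgquad s (hsubI hs) (abs_le.2 (hsub hs).2)).2
    have h2 := (abs_le.1 (he s (hsubI hs))).2
    have h3 := mul_le_mul_of_nonneg_left (min_le_left (s ^ 2) |s|) hγ.le
    rw [hf]
    linarith
  have hk : ConvexOn ℝ (Icc b₁ b₂) (h ⊔ φ) := hh.sup (hφ.subset hsubI (convex_Icc _ _))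
  have hkf : ∀ y ∈ Icc b₁ b₂, (h ⊔ φ) y ≤ f y :=
    fun y hy ↦ sup_le (hhf y hy) (hφf y (hsubI hy))
  obtain ⟨p, hp⟩ := hk.exists_supporting_line (x := x) (by rw [interior_Icc]; exact ⟨hbx, hxb⟩)
  have hxv : φ x ≤ (h ⊔ φ) x := le_sup_right
  have hxh : h x ≤ (h ⊔ φ) x := le_sup_left
  generalize (h ⊔ φ) x = v at hp hxv hxh
  have hpf : ∀ y ∈ Icc b₁ b₂, v + p * (y - x) ≤ f y := fun y hy ↦ (hp y hy).trans (hkf y hy)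
  have key : ∀ b ∈ Icc b₁ b₂, 20 * c < γ * (x ^ 2 + b ^ 2 - 6 * x * b) →
      v + p * (b - x) ≤ φ b := fun b hb hgap ↦ by
    have hm : (x + b) / 2 ∈ Icc b₁ b₂ :=
      ⟨by linarith [hxJ.1, hb.1], by linarith [hxJ.2, hb.2]⟩
    exact (affine_le_of_quadratic_gap ((hφlb x hxJ).trans hxv)
      ((hpf _ hm).trans (hfub _ hm)) hgap).trans (hφlb b hb)
  have hconv : ConvexOn ℝ (Icc l u) fun y ↦ v + p * (y - x) := by
    refine ⟨convex_Icc l u, fun y _ z _ α β _ _ hαβ ↦ le_of_eq ?_⟩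
    obtain rfl : α = 1 - β := by linarith
    simp only [smul_eq_mul]
    ring
  refine hxh.trans ?_
  have := le_gcm (f := f) hxI hconv fun y hy ↦ ?_
  · simpa using this
  rcases lt_or_ge y b₁ with hy₁ | hy₁
  · refine (hφ.affine_le_of_mem_openSegment hxI hy ?_ hxv
      (key b₁ ⟨le_rfl, by linarith⟩ gap₁)).trans (hφf y hy)
    rw [openSegment_symm, openSegment_eq_Ioo (hy₁.trans hbx)]
    exact ⟨hy₁, hbx⟩
  rcases lt_or_ge b₂ y with hy₂ | hy₂
  · refine (hφ.affine_le_of_mem_openSegment hxI hy ?_ hxv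
      (key b₂ ⟨by linarith, le_rfl⟩ gap₂)).trans (hφf y hy)
    rw [openSegment_eq_Ioo (hxb.trans hy₂)]
    exact ⟨hxb, hy₂⟩
  exact hpf y ⟨hy₁, hy₂⟩
end
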